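/- There exists a 3-symmetric set P of 42 points in general position in the plane with cr(P) = 40593. In particular, the rectilinear crossing number satisfies cr(K_42) ≤ 40593 (improving the previously best known bound of 40595). -/

import Mathlib

/-- A finite planar point set is in general position if no three of its points are collinear. -/
def GenPos (P : Finset (ℝ × ℝ)) : Prop :=
  ∀ p ∈ P, ∀ q ∈ P, ∀ r ∈ P, p ≠ q → p ≠ r → q ≠ r →
    ¬ Collinear ℝ ({p, q, r} : Set (ℝ × ℝ))

/-- A set of points is in convex position if no point lies in the convex hull of the others. -/
def ConvexPos (S : Set (ℝ × ℝ)) : Prop :=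
  ∀ p ∈ S, p ∉ convexHull ℝ (S \ {p})

/-- `crNum P` is the number of 4-element subsets of `P` in convex position. -/
noncomputable def crNum (P : Finset (ℝ × ℝ)) : ℕ :=
  Set.ncard {Q : Finset (ℝ × ℝ) | Q ⊆ P ∧ Q.card = 4 ∧ ConvexPos (↑Q : Set (ℝ × ℝ))}

/-- The rectilinear crossing number of `K_n`: the minimum of `crNum P` over all sets `P` of `n`
points in general position in the plane. -/
noncomputable def rcn (n : ℕ) : ℕ :=
  sInf {c : ℕ | ∃ P : Finset (ℝ × ℝ), P.card = n ∧ GenPos P ∧ crNum P = c}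

/-- Rotation by angle `2π/3` about the point `o`. -/
noncomputable def rot120 (o p : ℝ × ℝ) : ℝ × ℝ :=
  (o.1 + Real.cos (2 * Real.pi / 3) * (p.1 - o.1) - Real.sin (2 * Real.pi / 3) * (p.2 - o.2),
   o.2 + Real.sin (2 * Real.pi / 3) * (p.1 - o.1) + Real.cos (2 * Real.pi / 3) * (p.2 - o.2))

/-- A planar point set is 3-symmetric if some rotation by `2π/3` about a point not in the set
maps the set onto itself. -/
def ThreeSym (P : Finset (ℝ × ℝ)) : Prop :=
  ∃ o : ℝ × ℝ, o ∉ P ∧ rot120 o '' (P : Set (ℝ × ℝ)) = (P : Set (ℝ × ℝ))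

/-! ### Counting subsets of a list -/

/-- The sum of `f a t` over all nonempty suffixes `a :: t` of a list. -/
def sumTails {α : Type*} (f : α → List α → ℕ) : List α → ℕ
  | [] => 0
  | a :: t => f a t + sumTails f t

theorem sumTails_congr {α : Type*} {f g : α → List α → ℕ} {l : List α}
    (h : ∀ a t, a :: t <:+ l → f a t = g a t) : sumTails f l = sumTails g l := by
  induction l with
  | nil => rfl
  | cons a t ih =>
    simp only [sumTails]
    rw [h a t List.suffix_rfl, ih fun b s hb => h b s (hb.trans (List.suffix_cons a t))]

open Classical in
theorem card_filter_powersetCard_succ {α : Type*} [DecidableEq α] (G : Finset α → Prop) (k : ℕ)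
    {l : List α} (hl : l.Nodup) :
    ((l.toFinset.powersetCard (k + 1)).filter G).card =
      sumTails (fun a t => ((t.toFinset.powersetCard k).filter fun Q => G (insert a Q)).card) l := by
  induction l with
  | nil => simp [sumTails]
  | cons a t ih =>
    obtain ⟨ha, ht⟩ := List.nodup_cons.1 hl
    have ha' : a ∉ t.toFinset := by simpa using ha
    have hmem : ∀ Q ∈ t.toFinset.powersetCard k, a ∉ Q := fun Q hQ h =>
      ha' ((Finset.mem_powersetCard.1 hQ).1 h)
    rw [List.toFinset_cons, Finset.powersetCard_succ_insert ha', Finset.filter_union,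
      Finset.card_union_of_disjoint, ih ht, sumTails, add_comm, Finset.filter_image,
      Finset.card_image_of_injOn]
    · intro Q hQ R hR h
      rw [Finset.mem_coe, Finset.mem_filter] at hQ hR
      rw [← Finset.erase_insert (hmem Q hQ.1), ← Finset.erase_insert (hmem R hR.1)]
      exact congrArg (fun S => S.erase a) h
    · refine Finset.disjoint_left.2 fun Q hQ hQ' => ?_
      obtain ⟨R, -, rfl⟩ := Finset.mem_image.1 (Finset.mem_filter.1 hQ').1
      exact ha' ((Finset.mem_powersetCard.1 (Finset.mem_filter.1 hQ).1).1
        (Finset.mem_insert_self a R))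

/-- The values of `f` on a list, as the digits of a number in base `64`. -/
def mask {α : Type*} (f : α → Bool) : List α → ℕ
  | [] => 0
  | a :: t => cond (f a) 1 0 + 64 * mask f t

theorem mask_xor {α : Type*} (f g : α → Bool) (l : List α) :
    mask f l ^^^ mask g l = mask (fun a => f a ^^ g a) l := by
  induction l with
  | nil => exact Nat.xor_self 0
  | cons a t ih =>
    have key : ∀ (x y : Bool) (m n : ℕ), (cond x 1 0 + 64 * m) ^^^ (cond y 1 0 + 64 * n) =
        cond (x ^^ y) 1 0 + 64 * (m ^^^ n) := by
      intro x y m n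
      refine Nat.eq_of_testBit_eq fun i => ?_
      have h : ∀ (z : Bool) (k : ℕ), (cond z 1 0 + 64 * k).testBit i =
          if i < 6 then (cond z 1 0 : ℕ).testBit i else k.testBit (i - 6) := by
        intro z k
        rw [add_comm]
        exact Nat.testBit_two_pow_mul_add k (i := 6) (by cases z <;> decide) i
      rw [Nat.testBit_xor, h, h, h, Nat.testBit_xor]
      split_ifs
      · cases x <;> cases y <;> simp
      · rfl
    simp only [mask, key, ih]

theorem mask_mod {α : Type*} (f : α → Bool) {l : List α} (hl : l.length < 63) :
    mask f l % 63 = sumTails (fun a _ => cond (f a) 1 0) l := by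
  have hmod : mask f l ≡ sumTails (fun a _ => cond (f a) 1 0) l [MOD 63] := by
    clear hl
    induction l with
    | nil => rfl
    | cons a t ih =>
      simp only [mask, sumTails, Nat.ModEq] at ih ⊢
      omega
  have hle : sumTails (fun a _ => cond (f a) 1 0) l ≤ l.length := by
    clear hl hmod
    induction l with
    | nil => rfl
    | cons a t ih =>
      have : (cond (f a) 1 0 : ℕ) ≤ 1 := by cases f a <;> simp
      simp only [sumTails, List.length_cons]
      omega
  exact Eq.trans hmod (Nat.mod_eq_of_lt (hle.trans_lt hl))

/-! ### Orientations and convex position in the plane -/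

/-- Twice the signed area of the triangle `p`, `q`, `r`. -/
def cross (p q r : ℝ × ℝ) : ℝ :=
  (q.1 - p.1) * (r.2 - p.2) - (q.2 - p.2) * (r.1 - p.1)

theorem collinear_iff_cross_eq_zero {p q r : ℝ × ℝ} (hpq : p ≠ q) :
    Collinear ℝ ({p, q, r} : Set (ℝ × ℝ)) ↔ cross p q r = 0 := by
  rw [collinear_iff_of_mem (Set.mem_insert p _)]
  constructor
  · rintro ⟨v, hv⟩
    obtain ⟨s, rfl⟩ := hv q (by simp)
    obtain ⟨t, rfl⟩ := hv r (by simp)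
    simp only [cross, vadd_eq_add, Prod.fst_add, Prod.snd_add, Prod.smul_fst, Prod.smul_snd,
      smul_eq_mul]
    ring
  · intro h
    have key : ∃ t : ℝ, r = t • (q - p) + p := by
      unfold cross at h
      by_cases h1 : q.1 - p.1 = 0
      · have h2 : q.2 - p.2 ≠ 0 := fun h2 =>
          hpq (Prod.ext (by linarith) (by linarith))
        refine ⟨(r.2 - p.2) / (q.2 - p.2), Prod.ext ?_ ?_⟩
        · simp only [Prod.fst_add, Prod.smul_fst, Prod.fst_sub, smul_eq_mul]
          field_simp
          linarith
        · simp only [Prod.snd_add, Prod.smul_snd, Prod.snd_sub, smul_eq_mul]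
          field_simp
          ring
      · refine ⟨(r.1 - p.1) / (q.1 - p.1), Prod.ext ?_ ?_⟩
        · simp only [Prod.fst_add, Prod.smul_fst, Prod.fst_sub, smul_eq_mul]
          field_simp
          ring
        · simp only [Prod.snd_add, Prod.smul_snd, Prod.snd_sub, smul_eq_mul]
          field_simp
          linarith
    refine ⟨q - p, ?_⟩
    rintro x (rfl | rfl | rfl)
    · exact ⟨0, by simp⟩
    · exact ⟨1, by simp⟩
    · exact key

theorem mem_convexHull_triple {p q r s : ℝ × ℝ} :
    p ∈ convexHull ℝ ({q, r, s} : Set (ℝ × ℝ)) ↔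
      ∃ x y z : ℝ, 0 ≤ x ∧ 0 ≤ y ∧ 0 ≤ z ∧ x + y + z = 1 ∧ x • q + y • r + z • s = p := by
  constructor
  · intro h
    rw [convexHull_insert (by simp), convexHull_pair] at h
    simp only [mem_convexJoin, Set.mem_singleton_iff, exists_eq_left] at h
    obtain ⟨_, ⟨a, b, ha, hb, hab, rfl⟩, c, d, hc, hd, hcd, rfl⟩ := h
    refine ⟨c, d * a, d * b, hc, by positivity, by positivity, ?_, ?_⟩
    · rw [add_assoc, ← mul_add, hab, mul_one, hcd]
    · rw [smul_add, smul_smul, smul_smul, add_assoc]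
  · rintro ⟨x, y, z, hx, hy, hz, hsum, rfl⟩
    have hconv := convex_convexHull ℝ ({q, r, s} : Set (ℝ × ℝ))
    have hsub := subset_convexHull ℝ ({q, r, s} : Set (ℝ × ℝ))
    have := hconv.sum_mem (t := Finset.univ) (w := ![x, y, z]) (z := ![q, r, s])
      (by intro i _; fin_cases i <;> simpa) (by simpa [Fin.sum_univ_three] using hsum)
      (by intro i _; fin_cases i <;> exact hsub (by simp))
    simpa [Fin.sum_univ_three] using this

/-- The product of the orientations of the four triangles spanned by four points. -/
def quadProd (p q r s : ℝ × ℝ) : ℝ :=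
  cross q r s * cross p r s * cross p q s * cross p q r

theorem quadProd_nonpos_of_mem_convexHull {p q r s : ℝ × ℝ}
    (h : p ∈ convexHull ℝ ({q, r, s} : Set (ℝ × ℝ))) : quadProd p q r s ≤ 0 := by
  obtain ⟨x, y, z, hx, hy, hz, hsum, rfl⟩ := mem_convexHull_triple.1 h
  obtain rfl : x = 1 - y - z := by linarith
  have : quadProd ((1 - y - z) • q + y • r + z • s) q r s =
      -((1 - y - z) * y * z * cross q r s ^ 4) := by
    simp only [quadProd, cross, Prod.fst_add, Prod.snd_add, Prod.smul_fst, Prod.smul_snd,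
      smul_eq_mul]
    ring
  rw [this, neg_nonpos]
  positivity

theorem mem_convexHull_of_cross {p q r s : ℝ × ℝ} (h1 : 0 < cross q r s * cross p r s)
    (h2 : cross q r s * cross p q s < 0) (h3 : 0 < cross q r s * cross p q r) :
    p ∈ convexHull ℝ ({q, r, s} : Set (ℝ × ℝ)) := by
  have h0 : cross q r s ≠ 0 := by
    intro h
    simp [h] at h1
  have hsq : 0 < cross q r s ^ 2 := by positivity
  refine mem_convexHull_triple.2 ⟨cross q r s * cross p r s / cross q r s ^ 2,
    -(cross q r s * cross p q s) / cross q r s ^ 2,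
    cross q r s * cross p q r / cross q r s ^ 2, (div_pos h1 hsq).le,
    (div_pos (neg_pos.2 h2) hsq).le, (div_pos h3 hsq).le, ?_, Prod.ext ?_ ?_⟩
  · field_simp
    simp only [cross]
    ring
  · simp only [Prod.fst_add, Prod.smul_fst, smul_eq_mul]
    field_simp
    simp only [cross]
    ring
  · simp only [Prod.snd_add, Prod.smul_snd, smul_eq_mul]
    field_simp
    simp only [cross]
    ring

theorem convexPos_iff_quadProd_pos {a b c d : ℝ × ℝ} (hab : a ≠ b) (hac : a ≠ c) (had : a ≠ d)
    (hbc : b ≠ c) (hbd : b ≠ d) (hcd : c ≠ d) (hA : cross b c d ≠ 0) (hB : cross a c d ≠ 0)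
    (hC : cross a b d ≠ 0) (hD : cross a b c ≠ 0) :
    ConvexPos ({a, b, c, d} : Set (ℝ × ℝ)) ↔ 0 < quadProd a b c d := by
  have ea : ({a, b, c, d} : Set (ℝ × ℝ)) \ {a} = {b, c, d} := by
    ext x; simp only [Set.mem_sdiff, Set.mem_insert_iff, Set.mem_singleton_iff]; grind
  have eb : ({a, b, c, d} : Set (ℝ × ℝ)) \ {b} = {a, c, d} := by
    ext x; simp only [Set.mem_sdiff, Set.mem_insert_iff, Set.mem_singleton_iff]; grind
  have ec : ({a, b, c, d} : Set (ℝ × ℝ)) \ {c} = {a, b, d} := by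
    ext x; simp only [Set.mem_sdiff, Set.mem_insert_iff, Set.mem_singleton_iff]; grind
  have ed : ({a, b, c, d} : Set (ℝ × ℝ)) \ {d} = {a, b, c} := by
    ext x; simp only [Set.mem_sdiff, Set.mem_insert_iff, Set.mem_singleton_iff]; grind
  have hconv : ConvexPos ({a, b, c, d} : Set (ℝ × ℝ)) ↔
      a ∉ convexHull ℝ ({b, c, d} : Set (ℝ × ℝ)) ∧ b ∉ convexHull ℝ ({a, c, d} : Set (ℝ × ℝ)) ∧
      c ∉ convexHull ℝ ({a, b, d} : Set (ℝ × ℝ)) ∧ d ∉ convexHull ℝ ({a, b, c} : Set (ℝ × ℝ)) := by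
    simp only [ConvexPos, Set.forall_mem_insert, Set.mem_singleton_iff, forall_eq, ea, eb, ec, ed]
  rw [hconv]
  constructor
  · rintro ⟨h1, h2, h3, h4⟩
    by_contra! hneg
    unfold quadProd at hneg
    have hb : cross b a d = -cross a b d ∧ cross b a c = -cross a b c := by
      simp only [cross]
      constructor <;> ring
    have hc : cross c b d = -cross b c d ∧ cross c a d = -cross a c d ∧
        cross c a b = cross a b c := by
      simp only [cross]
      refine ⟨?_, ?_, ?_⟩ <;> ring
    have hd : cross d b c = cross b c d ∧ cross d a c = cross a c d ∧
        cross d a b = cross a b d := by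
      simp only [cross]
      refine ⟨?_, ?_, ?_⟩ <;> ring
    have h1 := fun x y z => h1 (mem_convexHull_of_cross x y z)
    have h2 := fun x y z => h2 (mem_convexHull_of_cross x y z)
    have h3 := fun x y z => h3 (mem_convexHull_of_cross x y z)
    have h4 := fun x y z => h4 (mem_convexHull_of_cross x y z)
    rw [hb.1, hb.2] at h2
    rw [hc.1, hc.2.1, hc.2.2] at h3
    rw [hd.1, hd.2.1, hd.2.2] at h4
    clear hb hc hd hconv ea eb ec ed
    generalize cross b c d = A at *
    generalize cross a c d = B at *
    generalize cross a b d = C at *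
    generalize cross a b c = D at *
    simp only [mul_pos_iff, mul_neg_iff, mul_nonpos_iff, mul_nonneg_iff, neg_pos, neg_lt_zero] at *
    grind
  · intro h
    refine ⟨fun hm => ?_, fun hm => ?_, fun hm => ?_, fun hm => ?_⟩ <;>
      refine (quadProd_nonpos_of_mem_convexHull hm).not_gt (h.trans_eq ?_) <;>
      simp only [quadProd, cross] <;> ring

/-! ### The point set -/

/-- The point `x + y * exp (2πi/3)` of the triangular lattice with coordinates `u = (x, y)`. -/
noncomputable def hexPoint (u : ℕ × ℕ) : ℝ × ℝ :=
  (u.1 - u.2 / 2, Real.sqrt 3 / 2 * u.2)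

theorem hexPoint_injective : Function.Injective hexPoint := by
  intro u v h
  obtain ⟨h1, h2⟩ := Prod.ext_iff.1 h
  have h3 : (u.2 : ℝ) = v.2 := mul_left_cancel₀ (by positivity) h2
  have h4 : (u.1 : ℝ) = v.1 := by
    simp only [hexPoint, h3] at h1
    linarith
  exact Prod.ext (by exact_mod_cast h4) (by exact_mod_cast h3)

/-- The positive terms in the expansion of the determinant of `b - a` and `c - a`. -/
def detPos (a b c : ℕ × ℕ) : ℕ :=
  a.1 * b.2 + (b.1 * c.2 + c.1 * a.2)

theorem cross_hexPoint (a b c : ℕ × ℕ) :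
    cross (hexPoint a) (hexPoint b) (hexPoint c) =
      Real.sqrt 3 / 2 * (detPos a b c - detPos b a c) := by
  simp only [cross, hexPoint, detPos]
  push_cast
  ring

/-- Whether the triangle `a`, `b`, `c` is oriented counterclockwise. -/
def isCCW (a b c : ℕ × ℕ) : Bool :=
  Nat.blt (detPos b a c) (detPos a b c)

theorem cross_hexPoint_eq_zero_iff {a b c : ℕ × ℕ} :
    cross (hexPoint a) (hexPoint b) (hexPoint c) = 0 ↔ detPos b a c = detPos a b c := by
  have : Real.sqrt 3 / 2 ≠ 0 := by positivity
  rw [cross_hexPoint, mul_eq_zero, or_iff_right this, sub_eq_zero, Nat.cast_inj, eq_comm]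

theorem cross_hexPoint_pos_iff {a b c : ℕ × ℕ} :
    0 < cross (hexPoint a) (hexPoint b) (hexPoint c) ↔ isCCW a b c = true := by
  have : 0 < Real.sqrt 3 / 2 := by positivity
  rw [cross_hexPoint, mul_pos_iff_of_pos_left this, sub_pos, Nat.cast_lt, isCCW, Nat.blt_eq]

/-- The number of degenerate triangles spanned by a list of points. -/
def numDegenerate (l : List (ℕ × ℕ)) : ℕ :=
  sumTails (fun a t => sumTails (fun b t => sumTails (fun c _ =>
    cond (Nat.beq (detPos b a c) (detPos a b c)) 1 0) t) t) l

/-- The number of convex quadrilaterals spanned by a list of at most 65 points in general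
position. The base-`64` digit sum of a mask is its residue modulo `63`. -/
def numConvexQuads (l : List (ℕ × ℕ)) : ℕ :=
  sumTails (fun a t => sumTails (fun b t => sumTails (fun c t =>
    (cond (isCCW a b c) 0 (mask (fun _ => true) t) ^^^ (mask (isCCW a b) t ^^^
      (mask (isCCW a c) t ^^^ mask (isCCW b c) t))) % 63) t) t) l

/-- A 3-symmetric set of 42 lattice points, with centre `(20000, 20000)`. -/
def latticePoints : List (ℕ × ℕ) :=
  [(20809, 16635), (23365, 24174), (15826, 19191),
   (19575, 19749), (20251, 19826), (20174, 20425),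
   (19355, 20063), (19937, 19292), (20708, 20645),
   (20235, 18427), (21573, 21808), (18192, 19765),
   (21057, 21385), (18615, 19672), (20328, 18943),
   (23232, 7686), (32314, 35546), (4454, 16768),
   (15125, 19026), (20974, 16099), (23901, 24875),
   (21505, 21743), (18257, 19762), (20238, 18495),
   (20823, 20688), (19312, 20135), (19865, 19177),
   (18533, 19695), (20305, 18838), (21162, 21467),
   (10314, 18007), (21993, 12307), (27693, 29686),
   (16779, 19350), (20650, 17429), (22571, 23221),
   (19537, 19748), (20252, 19789), (20211, 20463),
   (21385, 14614), (25386, 26771), (13229, 18615)]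

set_option maxRecDepth 100000 in
theorem numDegenerate_latticePoints : numDegenerate latticePoints = 0 := by
  decide +kernel

set_option maxRecDepth 100000 in
theorem numConvexQuads_latticePoints : numConvexQuads latticePoints = 40593 := by
  decide +kernel

theorem nodup_latticePoints : latticePoints.Nodup := by
  decide +kernel

theorem forall_rot_latticePoints :
    (∀ u ∈ latticePoints, ∃ v ∈ latticePoints, v.1 + u.2 = 40000 ∧ v.2 + u.2 = u.1 + 20000) ∧
    ∀ v ∈ latticePoints, ∃ u ∈ latticePoints, v.1 + u.2 = 40000 ∧ v.2 + u.2 = u.1 + 20000 := by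
  decide +kernel

theorem rot120_hexPoint {u v : ℕ × ℕ} (h1 : v.1 + u.2 = 40000) (h2 : v.2 + u.2 = u.1 + 20000) :
    rot120 (hexPoint (20000, 20000)) (hexPoint u) = hexPoint v := by
  have hang : 2 * Real.pi / 3 = Real.pi - Real.pi / 3 := by ring
  have h1' : (v.1 : ℝ) = 40000 - u.2 := eq_sub_of_add_eq (by exact_mod_cast h1)
  have h2' : (v.2 : ℝ) = u.1 + 20000 - u.2 := eq_sub_of_add_eq (by exact_mod_cast h2)
  have h3 : Real.sqrt 3 * Real.sqrt 3 = 3 := Real.mul_self_sqrt (by norm_num)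
  simp only [rot120, hexPoint, hang, Real.cos_pi_sub, Real.sin_pi_sub, Real.cos_pi_div_three,
    Real.sin_pi_div_three, h1', h2']
  refine Prod.ext ?_ ?_ <;> push_cast
  · linear_combination (-(1 / 4) * ((u.2 : ℝ) - 20000)) * h3
  · ring

theorem card_latticePoints : latticePoints.toFinset.card = 42 := by
  rw [List.toFinset_card_of_nodup nodup_latticePoints]
  rfl

open Classical in
theorem cross_latticePoints_ne_zero {a b c : ℕ × ℕ} (ha : a ∈ latticePoints)
    (hb : b ∈ latticePoints) (hc : c ∈ latticePoints) (hab : a ≠ b) (hac : a ≠ c) (hbc : b ≠ c) :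
    cross (hexPoint a) (hexPoint b) (hexPoint c) ≠ 0 := by
  have hcount := card_filter_powersetCard_succ
    (fun Q : Finset (ℕ × ℕ) => Collinear ℝ (hexPoint '' Q)) 2 nodup_latticePoints
  have hzero : sumTails (fun a t => ((t.toFinset.powersetCard 2).filter
      fun Q : Finset (ℕ × ℕ) => Collinear ℝ (hexPoint '' ↑(insert a Q))).card) latticePoints = 0 := by
    rw [← numDegenerate_latticePoints, numDegenerate]
    refine sumTails_congr fun a t hat => ?_
    have hnd : (a :: t).Nodup := nodup_latticePoints.sublist hat.sublist
    rw [card_filter_powersetCard_succ _ _ (List.nodup_cons.1 hnd).2]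
    refine sumTails_congr fun b t' hbt => ?_
    have hnd' : (b :: t').Nodup := (List.nodup_cons.1 hnd).2.sublist hbt.sublist
    rw [card_filter_powersetCard_succ _ _ (List.nodup_cons.1 hnd').2]
    refine sumTails_congr fun c _ _ => ?_
    have hab : a ≠ b := fun h => (List.nodup_cons.1 hnd).1 (h ▸ hbt.subset List.mem_cons_self)
    have hcol : Collinear ℝ (hexPoint '' ↑(insert a (insert b (insert c (∅ : Finset (ℕ × ℕ)))))) ↔
        (Nat.beq (detPos b a c) (detPos a b c)) = true := by
      rw [Nat.beq_eq, ← cross_hexPoint_eq_zero_iff,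
        ← collinear_iff_cross_eq_zero (hexPoint_injective.ne hab)]
      simp [Set.image_insert_eq]
    rw [Finset.powersetCard_zero, Finset.filter_singleton]
    by_cases h : Nat.beq (detPos b a c) (detPos a b c) = true
    · rw [if_pos (hcol.2 h), h]
      rfl
    · rw [if_neg (mt hcol.1 h), Bool.eq_false_of_not_eq_true h]
      rfl
  rw [hzero, Finset.card_eq_zero, Finset.filter_eq_empty_iff] at hcount
  intro h
  refine hcount (x := {a, b, c}) (Finset.mem_powersetCard.2 ⟨?_, ?_⟩) ?_
  · simp [Finset.insert_subset_iff, ha, hb, hc]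
  · exact Finset.card_eq_three.2 ⟨a, b, c, hab, hac, hbc, rfl⟩
  · simpa [Set.image_insert_eq] using
      (collinear_iff_cross_eq_zero (hexPoint_injective.ne hab)).2 h

theorem convexPos_iff_isCCW {a b c d : ℕ × ℕ} (h : [a, b, c, d].Sublist latticePoints) :
    ConvexPos (hexPoint '' {a, b, c, d}) ↔
      ((!isCCW a b c) ^^ (isCCW a b d ^^ (isCCW a c d ^^ isCCW b c d))) = true := by
  have hnd := nodup_latticePoints.sublist h
  have hmem := h.subset
  simp only [List.nodup_cons, List.mem_cons, List.not_mem_nil, or_false, not_or] at hnd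
  obtain ⟨⟨hab, hac, had⟩, ⟨hbc, hbd⟩, hcd, -⟩ := hnd
  simp only [List.cons_subset, List.nil_subset, and_true] at hmem
  obtain ⟨ha, hb, hc, hd⟩ := hmem
  have hA := cross_latticePoints_ne_zero hb hc hd hbc hbd hcd
  have hB := cross_latticePoints_ne_zero ha hc hd hac had hcd
  have hC := cross_latticePoints_ne_zero ha hb hd hab had hbd
  have hD := cross_latticePoints_ne_zero ha hb hc hab hac hbc
  rw [Set.image_insert_eq, Set.image_insert_eq, Set.image_pair, convexPos_iff_quadProd_pos
    (hexPoint_injective.ne hab) (hexPoint_injective.ne hac) (hexPoint_injective.ne had)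
    (hexPoint_injective.ne hbc) (hexPoint_injective.ne hbd) (hexPoint_injective.ne hcd)
    hA hB hC hD, quadProd]
  have eA := cross_hexPoint_pos_iff (a := b) (b := c) (c := d)
  have eB := cross_hexPoint_pos_iff (a := a) (b := c) (c := d)
  have eC := cross_hexPoint_pos_iff (a := a) (b := b) (c := d)
  have eD := cross_hexPoint_pos_iff (a := a) (b := b) (c := c)
  generalize cross (hexPoint b) (hexPoint c) (hexPoint d) = A at *
  generalize cross (hexPoint a) (hexPoint c) (hexPoint d) = B at *
  generalize cross (hexPoint a) (hexPoint b) (hexPoint d) = C at *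
  generalize cross (hexPoint a) (hexPoint b) (hexPoint c) = D at *
  simp only [mul_pos_iff, mul_neg_iff]
  grind

open Classical in
theorem card_convexPos_latticePoints :
    ((latticePoints.toFinset.powersetCard 4).filter fun Q : Finset (ℕ × ℕ) =>
      ConvexPos (hexPoint '' (Q : Set (ℕ × ℕ)))).card = 40593 := by
  rw [← numConvexQuads_latticePoints, numConvexQuads,
    card_filter_powersetCard_succ _ _ nodup_latticePoints]
  refine sumTails_congr fun a ta ha => ?_
  have hnda := (nodup_latticePoints.sublist ha.sublist).of_cons
  rw [card_filter_powersetCard_succ _ _ hnda]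
  refine sumTails_congr fun b tb hb => ?_
  have hndb := (hnda.sublist hb.sublist).of_cons
  rw [card_filter_powersetCard_succ _ _ hndb]
  refine sumTails_congr fun c tc hc => ?_
  have hndc := (hndb.sublist hc.sublist).of_cons
  have hsub : (a :: b :: c :: tc).Sublist latticePoints :=
    (((hc.sublist.cons_cons b).trans hb.sublist).cons_cons a).trans ha.sublist
  have hlen : tc.length < 63 := by
    have h : (a :: b :: c :: tc).length ≤ 42 := hsub.length_le
    simp only [List.length_cons] at h
    omega
  have hcond : cond (isCCW a b c) 0 (mask (fun _ => true) tc) = mask (fun _ => !isCCW a b c) tc := by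
    cases isCCW a b c
    · rfl
    · have : ∀ l : List (ℕ × ℕ), mask (fun _ => false) l = 0 := by
        intro l
        induction l with
        | nil => rfl
        | cons _ _ ih => simp [mask, ih]
      exact (this tc).symm
  rw [hcond, mask_xor, mask_xor, mask_xor, mask_mod _ hlen, card_filter_powersetCard_succ _ _ hndc]
  refine sumTails_congr fun d td hd => ?_
  have hquad := convexPos_iff_isCCW (((((((List.nil_sublist td).cons_cons d).trans
    hd.sublist).cons_cons c).cons_cons b).cons_cons a).trans hsub)
  have hset : ((insert a (insert b (insert c (insert d (∅ : Finset (ℕ × ℕ))))) :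
      Finset (ℕ × ℕ)) : Set (ℕ × ℕ)) = {a, b, c, d} := by
    simp
  rw [Finset.powersetCard_zero, Finset.filter_singleton, hset]
  by_cases h : ConvexPos (hexPoint '' {a, b, c, d})
  · rw [if_pos h, hquad.1 h]
    rfl
  · rw [if_neg h, Bool.eq_false_of_not_eq_true (mt hquad.2 h)]
    rfl

/-- The image of `latticePoints` in the plane. -/
noncomputable def planePoints : Finset (ℝ × ℝ) :=
  latticePoints.toFinset.map ⟨hexPoint, hexPoint_injective⟩

theorem card_planePoints : planePoints.card = 42 := by
  rw [planePoints, Finset.card_map, card_latticePoints]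

theorem mem_planePoints {p : ℝ × ℝ} : p ∈ planePoints ↔ ∃ u ∈ latticePoints, hexPoint u = p := by
  simp only [planePoints, Finset.mem_map, List.mem_toFinset, Function.Embedding.coeFn_mk]

theorem genPos_planePoints : GenPos planePoints := by
  intro p hp q hq r hr hpq hpr hqr
  obtain ⟨a, ha, rfl⟩ := mem_planePoints.1 hp
  obtain ⟨b, hb, rfl⟩ := mem_planePoints.1 hq
  obtain ⟨c, hc, rfl⟩ := mem_planePoints.1 hr
  rw [collinear_iff_cross_eq_zero hpq]
  exact cross_latticePoints_ne_zero ha hb hc (ne_of_apply_ne _ hpq) (ne_of_apply_ne _ hpr)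
    (ne_of_apply_ne _ hqr)

theorem threeSym_planePoints : ThreeSym planePoints := by
  refine ⟨hexPoint (20000, 20000), fun h => ?_, Set.Subset.antisymm ?_ ?_⟩
  · obtain ⟨u, hu, huo⟩ := mem_planePoints.1 h
    rw [hexPoint_injective huo] at hu
    revert hu
    decide +kernel
  · rintro _ ⟨p, hp, rfl⟩
    obtain ⟨u, hu, rfl⟩ := mem_planePoints.1 hp
    obtain ⟨v, hv, h1, h2⟩ := forall_rot_latticePoints.1 u hu
    exact mem_planePoints.2 ⟨v, hv, (rot120_hexPoint h1 h2).symm⟩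
  · intro p hp
    obtain ⟨v, hv, rfl⟩ := mem_planePoints.1 hp
    obtain ⟨u, hu, h1, h2⟩ := forall_rot_latticePoints.2 v hv
    exact ⟨hexPoint u, mem_planePoints.2 ⟨u, hu, rfl⟩, rot120_hexPoint h1 h2⟩

open Classical in
theorem crNum_planePoints : crNum planePoints = 40593 := by
  have hset : {Q : Finset (ℝ × ℝ) | Q ⊆ planePoints ∧ Q.card = 4 ∧
        ConvexPos (↑Q : Set (ℝ × ℝ))} =
      Finset.map ⟨hexPoint, hexPoint_injective⟩ ''
        ((latticePoints.toFinset.powersetCard 4).filter fun Q : Finset (ℕ × ℕ) =>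
          ConvexPos (hexPoint '' (Q : Set (ℕ × ℕ))) : Finset (Finset (ℕ × ℕ))) := by
    ext Q
    simp only [Set.mem_ofPred_eq, Set.mem_image, Finset.mem_coe, Finset.mem_filter,
      Finset.mem_powersetCard]
    constructor
    · rintro ⟨hQ, hcard, hconv⟩
      obtain ⟨R, hR, rfl⟩ := Finset.subset_map_iff.1 hQ
      rw [Finset.card_map] at hcard
      rw [Finset.coe_map] at hconv
      exact ⟨R, ⟨⟨hR, hcard⟩, hconv⟩, rfl⟩
    · rintro ⟨R, ⟨⟨hR, hcard⟩, hconv⟩, rfl⟩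
      refine ⟨Finset.map_subset_map.2 hR, by rwa [Finset.card_map], ?_⟩
      rwa [Finset.coe_map]
  rw [crNum, hset, Set.ncard_image_of_injective _ (Finset.map_injective _), Set.ncard_coe_finset,
    card_convexPos_latticePoints]

/-- There is a 3-symmetric set of 42 points in general position with exactly 40593 convex
quadrilaterals; in particular the rectilinear crossing number of `K_42` is at most 40593. -/
theorem exists_good_drawing_K42 :
    ∃ P : Finset (ℝ × ℝ), P.card = 42 ∧ GenPos P ∧ ThreeSym P ∧ crNum P = 40593 ∧
      rcn 42 ≤ 40593 := by
  exact ⟨planePoints, card_planePoints, genPos_planePoints, threeSym_planePoints, crNum_planePoints,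
    Nat.sInf_le ⟨planePoints, card_planePoints, genPos_planePoints, crNum_planePoints⟩⟩
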